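/- arXiv:0707.0200 — 6 statements merged into one kernel-verified Lean document; each statement's English description precedes it below -/
import Mathlib

section
/- Let E be a finite-dimensional real normed vector space, and let a, b : E → E → ℝ be symmetric bilinear forms which are positive definite (a(y,y) > 0 and b(y,y) > 0 for all y ≠ 0). Define the extraordinary metric F_e : E \ {0} → ℝ by F_e(y) = a(y,y) / Real.sqrt (b(y,y)) and set G(y) = (1/2) * (F_e y)^2 = a(y,y)^2 / (2 * b(y,y)). Then for every y ≠ 0, G is twice Fréchet differentiable at y and for all v, w ∈ E: D²G(y)(v,w) = F_e(y)^2 * ( 2*a(v,w)/a(y,y) − b(v,w)/b(y,y) ) + 4 * c(v) * c(w) / b(y,y)^3, where c(v) := a(y,y) * b(y,v) − b(y,y) * a(y,v). -/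
/-- The diagonal of a symmetric continuous bilinear form `B` has derivative `2 B(y, ·)` at `y`. -/
theorem hasFDerivAt_diagonal_of_symm {E : Type*} [NormedAddCommGroup E] [NormedSpace ℝ E]
    (B : E →L[ℝ] E →L[ℝ] ℝ) (hB : ∀ v w : E, B v w = B w v) (y : E) :
    HasFDerivAt (fun z => B z z) ((2 : ℝ) • B y) y := by
  refine (B.hasFDerivAt.clm_apply (hasFDerivAt_id y)).congr_fderiv ?_
  ext v
  simp [hB v y, two_mul]

/-- The derivative of `z ↦ A(z,z)² / (2 B(z,z))` for symmetric continuous bilinear forms. -/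
theorem hasFDerivAt_sq_diagonal_div {E : Type*} [NormedAddCommGroup E] [NormedSpace ℝ E]
    (A B : E →L[ℝ] E →L[ℝ] ℝ) (hA : ∀ v w : E, A v w = A w v) (hB : ∀ v w : E, B v w = B w v)
    (y : E) (hy : B y y ≠ 0) :
    HasFDerivAt (fun z => A z z ^ 2 / (2 * B z z))
      ((2 * A y y * (B y y)⁻¹) • A y - (A y y ^ 2 * (B y y)⁻¹ ^ 2) • B y) y := by
  have hinv := (hasDerivAt_inv hy).comp_hasFDerivAt (f := fun z => B z z) y
    (hasFDerivAt_diagonal_of_symm B hB y)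
  have h := (((hasFDerivAt_diagonal_of_symm A hA y).pow 2).mul hinv).const_mul (1 / 2)
  refine (h.congr_fderiv ?_).congr_of_eventuallyEq (.of_forall fun z => ?_)
  · ext v
    simp
    field_simp
    ring
  · simp
    ring

/-- The derivative of the differential of `z ↦ A(z,z)² / (2 B(z,z))`, evaluated on two vectors. -/
theorem exists_hasFDerivAt_differential_sq_diagonal_div {E : Type*} [NormedAddCommGroup E]
    [NormedSpace ℝ E] (A B : E →L[ℝ] E →L[ℝ] ℝ) (hA : ∀ v w : E, A v w = A w v)
    (hB : ∀ v w : E, B v w = B w v) (y : E) (hAy : A y y ≠ 0) (hBy : B y y ≠ 0) :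
    ∃ D : E →L[ℝ] E →L[ℝ] ℝ,
      HasFDerivAt
        (fun z => (2 * A z z * (B z z)⁻¹) • A z - (A z z ^ 2 * (B z z)⁻¹ ^ 2) • B z) D y ∧
      ∀ v w : E, D v w =
        A y y ^ 2 / B y y * (2 * A v w / A y y - B v w / B y y) +
          4 * (A y y * B y v - B y y * A y v) * (A y y * B y w - B y y * A y w) / B y y ^ 3 := by
  have hdiag := hasFDerivAt_diagonal_of_symm A hA y
  have hinv := (hasDerivAt_inv hBy).comp_hasFDerivAt (f := fun z => B z z) y
    (hasFDerivAt_diagonal_of_symm B hB y)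
  refine ⟨_, (((hdiag.const_mul 2).mul hinv).smul A.hasFDerivAt).sub
    (((hdiag.pow 2).mul (hinv.pow 2)).smul B.hasFDerivAt), fun v w => ?_⟩
  simp
  field_simp
  ring

/-- Fundamental tensor of the extraordinary Finsler metric
`F_e(y) = a(y,y)/√(b(y,y))` of a uniaxial birefringent medium: with
`G = ½F_e² = a(y,y)²/(2 b(y,y))`, for `y ≠ 0` the function `G` is twice
Fréchet differentiable at `y` and
`D²G(y)(v,w) = F_e(y)²(2a(v,w)/a(y,y) − b(v,w)/b(y,y)) + 4 c(v) c(w)/b(y,y)³`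
where `c(v) = a(y,y) b(y,v) − b(y,y) a(y,v)`. -/
theorem extraordinary_metric_fundamental_tensor
    {E : Type*} [NormedAddCommGroup E] [NormedSpace ℝ E] [FiniteDimensional ℝ E]
    (a b : E →ₗ[ℝ] E →ₗ[ℝ] ℝ)
    (ha_symm : ∀ v w : E, a v w = a w v) (hb_symm : ∀ v w : E, b v w = b w v)
    (ha_pos : ∀ y : E, y ≠ 0 → 0 < a y y) (hb_pos : ∀ y : E, y ≠ 0 → 0 < b y y)
    (Fe : E → ℝ) (hFe : ∀ y : E, Fe y = a y y / Real.sqrt (b y y))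
    (G : E → ℝ) (hG : G = fun y => (a y y) ^ 2 / (2 * b y y))
    (y : E) (hy : y ≠ 0) :
    DifferentiableAt ℝ G y ∧ DifferentiableAt ℝ (fderiv ℝ G) y ∧
      ∀ v w : E,
        fderiv ℝ (fderiv ℝ G) y v w =
          (Fe y) ^ 2 * (2 * a v w / a y y - b v w / b y y) +
            4 * (a y y * b y v - b y y * a y v) * (a y y * b y w - b y y * a y w) /
              (b y y) ^ 3 := by
  set A : E →L[ℝ] E →L[ℝ] ℝ := LinearMap.toContinuousBilinearMap a
  set B : E →L[ℝ] E →L[ℝ] ℝ := LinearMap.toContinuousBilinearMap b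
  have hG' : ∀ z : E, z ≠ 0 → HasFDerivAt G
      ((2 * A z z * (B z z)⁻¹) • A z - (A z z ^ 2 * (B z z)⁻¹ ^ 2) • B z) z := fun z hz =>
    hG ▸ hasFDerivAt_sq_diagonal_div A B ha_symm hb_symm z (hb_pos z hz).ne'
  obtain ⟨D, hD, hDvw⟩ := exists_hasFDerivAt_differential_sq_diagonal_div A B ha_symm hb_symm y
    (ha_pos y hy).ne' (hb_pos y hy).ne'
  have hfderiv : HasFDerivAt (fderiv ℝ G) D y :=
    hD.congr_of_eventuallyEq ((eventually_ne_nhds hy).mono fun z hz => (hG' z hz).fderiv)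
  refine ⟨(hG' y hy).differentiableAt, hfderiv.differentiableAt, fun v w => ?_⟩
  rw [hfderiv.fderiv, hFe, div_pow, Real.sq_sqrt (hb_pos y hy).le]
  exact hDvw v w
end

section
/- Let E be a finite-dimensional real normed vector space, and let a, b : E → E → ℝ be symmetric positive-definite bilinear forms such that b(y,y)/Real.sqrt 2 < a(y,y) < Real.sqrt 2 * b(y,y) for every y ≠ 0. Define G(y) = a(y,y)^2 / (2 * b(y,y)) (which equals ½ F_e(y)² for the extraordinary metric F_e(y) = a(y,y)/√(b(y,y))). Then for every y ≠ 0 the second Fréchet derivative D²G(y) is positive definite: D²G(y)(v,v) > 0 for all v ≠ 0. -/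
open Filter Topology in
/-- The second derivative of `y ↦ a(y,y)² / (2 b(y,y))` on the diagonal, with the square completed. -/
lemma fderiv_fderiv_sq_div_bilinear {E : Type*} [NormedAddCommGroup E] [NormedSpace ℝ E]
    (a b : E →L[ℝ] E →L[ℝ] ℝ)
    (ha : ∀ v w : E, a v w = a w v) (hb : ∀ v w : E, b v w = b w v)
    (y v : E) (hy : b y y ≠ 0) :
    fderiv ℝ (fderiv ℝ fun x => (a x x) ^ 2 / (2 * b x x)) y v v =
      4 * (a y v - a y y / b y y * b y v) ^ 2 / b y y
        + a y y / b y y * (2 * a v v - a y y / b y y * b v v) := by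
  have hA (x : E) : HasFDerivAt (fun x => a x x) ((2 : ℝ) • a x) x := by
    refine (a.hasFDerivAt.clm_apply (hasFDerivAt_id x)).congr_fderiv ?_
    ext w
    simp [ha w x, two_mul]
  have hB (x : E) : HasFDerivAt (fun x => b x x) ((2 : ℝ) • b x) x := by
    refine (b.hasFDerivAt.clm_apply (hasFDerivAt_id x)).congr_fderiv ?_
    ext w
    simp [hb w x, two_mul]
  have hQ (x : E) (hx : b x x ≠ 0) : HasFDerivAt (fun x => a x x / b x x)
      ((b x x)⁻¹ • ((2 : ℝ) • a x) - (a x x / b x x ^ 2) • ((2 : ℝ) • b x)) x := by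
    have hinv := HasDerivAt.comp_hasFDerivAt (f := fun x => b x x) x (hasDerivAt_inv hx) (hB x)
    refine ((hA x).fun_mul hinv).congr_fderiv ?_
    ext w
    simp
    field_simp
    ring
  have hG (x : E) (hx : b x x ≠ 0) : fderiv ℝ (fun x => (a x x) ^ 2 / (2 * b x x)) x =
      (a x x / b x x) • ((2 : ℝ) • a x) - (a x x / b x x) ^ 2 • b x := by
    have hfun : (fun x => (a x x) ^ 2 / (2 * b x x)) =
        fun x => (1 / 2 : ℝ) * (a x x * (a x x / b x x)) := by
      ext x
      ring
    rw [hfun]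
    refine ((((hA x).fun_mul (hQ x hx)).const_mul (1 / 2)).congr_fderiv ?_).fderiv
    ext w
    simp
    field_simp
    ring
  have hev : fderiv ℝ (fun x => (a x x) ^ 2 / (2 * b x x)) =ᶠ[𝓝 y]
      fun x => (a x x / b x x) • ((2 : ℝ) • a x) - (a x x / b x x) ^ 2 • b x := by
    filter_upwards [(hB y).continuousAt.eventually_ne hy] with x hx using hG x hx
  rw [hev.fderiv_eq]
  have hD := ((hQ y hy).fun_smul (a.hasFDerivAt.const_smul (2 : ℝ))).fun_sub
    (((hQ y hy).pow 2).fun_smul (b.hasFDerivAt (x := y)))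
  rw [HasFDerivAt.fderiv (f := fun x => (a x x / b x x) • ((2 : ℝ) • a x) -
    (a x x / b x x) ^ 2 • b x) hD]
  simp
  field_simp
  ring

/-- If the symmetric positive-definite bilinear forms `a`, `b` satisfy the pinching
`b(y,y)/√2 < a(y,y) < √2·b(y,y)` for `y ≠ 0`, then the fundamental tensor of the
extraordinary metric `F_e(y) = a(y,y)/√(b(y,y))`, i.e. the second derivative of
`G(y) = a(y,y)²/(2 b(y,y))`, is positive definite at every `y ≠ 0`. -/
theorem extraordinary_metric_positive_definite
    {E : Type*} [NormedAddCommGroup E] [NormedSpace ℝ E] [FiniteDimensional ℝ E]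
    (a b : E →ₗ[ℝ] E →ₗ[ℝ] ℝ)
    (ha_symm : ∀ v w : E, a v w = a w v) (hb_symm : ∀ v w : E, b v w = b w v)
    (ha_pos : ∀ y : E, y ≠ 0 → 0 < a y y) (hb_pos : ∀ y : E, y ≠ 0 → 0 < b y y)
    (hpinch : ∀ y : E, y ≠ 0 →
      b y y / Real.sqrt 2 < a y y ∧ a y y < Real.sqrt 2 * b y y)
    (G : E → ℝ) (hG : G = fun y => (a y y) ^ 2 / (2 * b y y))
    (y : E) (hy : y ≠ 0) (v : E) (hv : v ≠ 0) :
    0 < fderiv ℝ (fderiv ℝ G) y v v := by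
  subst hG
  set a' : E →L[ℝ] E →L[ℝ] ℝ := a.toContinuousBilinearMap
  set b' : E →L[ℝ] E →L[ℝ] ℝ := b.toContinuousBilinearMap
  have key := fderiv_fderiv_sq_div_bilinear a' b' ha_symm hb_symm y v (hb_pos y hy).ne'
  refine lt_of_lt_of_eq ?_ key.symm
  change 0 < 4 * (a y v - a y y / b y y * b y v) ^ 2 / b y y
        + a y y / b y y * (2 * a v v - a y y / b y y * b v v)
  have hBy := hb_pos y hy
  have hBv := hb_pos v hv
  have hq : 0 < a y y / b y y := div_pos (ha_pos y hy) hBy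
  have hq2 : a y y / b y y < √2 := (div_lt_iff₀ hBy).2 (hpinch y hy).2
  have hv2 : √2 * b v v < 2 * a v v := by
    have h := (div_lt_iff₀ (by positivity)).1 (hpinch v hv).1
    calc √2 * b v v < √2 * (a v v * √2) := by gcongr
      _ = 2 * a v v := by linear_combination a v v * Real.mul_self_sqrt (zero_le_two (α := ℝ))
  have hlt : a y y / b y y * b v v < √2 * b v v := by gcongr
  have hpos := mul_pos hq (sub_pos.2 (hlt.trans hv2))
  positivity
end

section
/- Let R be a real 3×3 matrix with Rᵀ * R = 1 and det R = 1, let x, P ∈ ℝ³, and let S be a real 3×3 skew-symmetric matrix. Define the 3×3 matrix x∧P by (x∧P)_{ij} = x_i P_j − x_j P_i, and set S′ = R * (S + x∧P) * Rᵀ and P′ = R.mulVec P. Then, with axial(S) := (S 2 1, S 0 2, S 1 0) (indices 0-based): (i) ⟨P′, P′⟩ = ⟨P, P⟩, and (ii) ⟨axial S′, P′⟩ = ⟨axial S, P⟩. -/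
open Matrix

/-- The axial vector of a 3×3 skew-symmetric matrix `S`. -/
def axial (S : Matrix (Fin 3) (Fin 3) ℝ) : Fin 3 → ℝ :=
  ![S 2 1, S 0 2, S 1 0]

theorem axial_add (A B : Matrix (Fin 3) (Fin 3) ℝ) : axial (A + B) = axial A + axial B := by
  ext i
  fin_cases i <;> simp [axial]

/-- Congruence by `R` acts on axial vectors through the cofactor matrix of `R`. -/
theorem axial_mul_mul_transpose (R : Matrix (Fin 3) (Fin 3) ℝ) {A : Matrix (Fin 3) (Fin 3) ℝ}
    (hA : Aᵀ = -A) : axial (R * A * Rᵀ) = axial A ᵥ* R.adjugate := by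
  have h (i j) : A j i = -A i j := congrFun (congrFun hA i) j
  have hd (i) : A i i = 0 := by linarith [h i i]
  ext i
  fin_cases i <;>
    simp [axial, adjugate_fin_three, vecMul, dotProduct, mul_apply, Fin.sum_univ_three,
      hd, h 2 1, h 0 2, h 1 0] <;>
    ring

theorem axial_mul_mul_transpose_dotProduct_mulVec (R : Matrix (Fin 3) (Fin 3) ℝ)
    {A : Matrix (Fin 3) (Fin 3) ℝ} (hA : Aᵀ = -A) (P : Fin 3 → ℝ) :
    axial (R * A * Rᵀ) ⬝ᵥ (R *ᵥ P) = R.det * (axial A ⬝ᵥ P) := by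
  rw [axial_mul_mul_transpose R hA, ← dotProduct_mulVec, mulVec_mulVec, adjugate_mul,
    smul_mulVec, one_mulVec, dotProduct_smul, smul_eq_mul]

/-- Invariance of the Casimirs `C = ⟨P,P⟩` and `C′ = ⟨axial S, P⟩` of `e(3)*`
under the coadjoint action `Coad_{(R,x)}(S,P) = (R(S + x∧P)Rᵀ, RP)` of `SE(3)`. -/
theorem euclidean_coadjoint_invariants
    (R : Matrix (Fin 3) (Fin 3) ℝ) (hR : Rᵀ * R = 1) (hdetR : R.det = 1)
    (x P : Fin 3 → ℝ)
    (S : Matrix (Fin 3) (Fin 3) ℝ) (hS : Sᵀ = -S)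
    (xP : Matrix (Fin 3) (Fin 3) ℝ) (hxP : ∀ i j, xP i j = x i * P j - x j * P i)
    (S' : Matrix (Fin 3) (Fin 3) ℝ) (hS' : S' = R * (S + xP) * Rᵀ)
    (P' : Fin 3 → ℝ) (hP' : P' = R.mulVec P) :
    P' ⬝ᵥ P' = P ⬝ᵥ P ∧ axial S' ⬝ᵥ P' = axial S ⬝ᵥ P := by
  subst hS' hP'
  have hA : (S + xP)ᵀ = -(S + xP) := by
    have hxPT : xPᵀ = -xP := by
      ext i j
      simp [hxP]
    rw [transpose_add, hS, hxPT, neg_add]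
  have hxP_dot : axial xP ⬝ᵥ P = 0 := by
    simp only [axial, hxP, vec3_dotProduct, cons_val]
    ring
  constructor
  · rw [dotProduct_mulVec, ← mulVec_transpose, mulVec_mulVec, hR, one_mulVec]
  · rw [axial_mul_mul_transpose_dotProduct_mulVec R hA, hdetR, one_mul, axial_add,
      add_dotProduct, hxP_dot, add_zero]
end

section
/- Let n ≥ 1, let u ∈ ℝⁿ with ‖u‖ = 1, and let p ≠ 0 be real. On the subspace V_u = {(a,b) ∈ ℝⁿ × ℝⁿ : ⟨u,b⟩ = 0} define the skew bilinear form σ((a,b),(a′,b′)) = p(⟨b,a′⟩ − ⟨b′,a⟩). Then the kernel of σ on V_u, i.e. {(a,b) ∈ V_u : σ((a,b),(a′,b′)) = 0 for all (a′,b′) ∈ V_u}, equals {(λ • u, 0) : λ ∈ ℝ}. -/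
open scoped RealInnerProductSpace

/-- The characteristic foliation for colored (spinless) light rays in vacuum:
on `V_u = {(a,b) : ⟨u,b⟩ = 0}`, the kernel of the skew bilinear form
`σ((a,b),(a′,b′)) = p(⟨b,a′⟩ − ⟨b′,a⟩)` is spanned by `(u, 0)`. -/
theorem spinless_characteristic_foliation
    (n : ℕ) (hn : 1 ≤ n)
    (u : EuclideanSpace ℝ (Fin n)) (hu : ‖u‖ = 1)
    (p : ℝ) (hp : p ≠ 0) :
    {ab : EuclideanSpace ℝ (Fin n) × EuclideanSpace ℝ (Fin n) |
        ⟪u, ab.2⟫ = 0 ∧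
        ∀ a' b' : EuclideanSpace ℝ (Fin n), ⟪u, b'⟫ = 0 →
          p * (⟪ab.2, a'⟫ - ⟪b', ab.1⟫) = 0} =
      {ab : EuclideanSpace ℝ (Fin n) × EuclideanSpace ℝ (Fin n) |
        ∃ l : ℝ, ab = (l • u, 0)} := by
  ext ⟨a, b⟩
  simp only [Set.mem_ofPred_eq, Prod.mk.injEq]
  constructor
  · rintro ⟨-, h⟩
    have hb : b = 0 := by
      simpa [hp] using h b 0 (inner_zero_right u)
    have huu : ⟪u, u⟫ = 1 := by rw [real_inner_self_eq_norm_sq, hu, one_pow]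
    have hperp : ⟪u, a - ⟪u, a⟫ • u⟫ = 0 := by
      rw [inner_sub_right, real_inner_smul_right, huu, mul_one, sub_self]
    have ha : ⟪a - ⟪u, a⟫ • u, a⟫ = 0 := by
      simpa [hp] using h 0 _ hperp
    refine ⟨⟪u, a⟫, sub_eq_zero.mp ((inner_self_eq_zero (𝕜 := ℝ)).mp ?_), hb⟩
    rw [inner_sub_right, ha, real_inner_smul_right, real_inner_comm u, hperp, mul_zero, sub_zero]
  · rintro ⟨l, rfl, rfl⟩
    refine ⟨inner_zero_right u, fun a' b' hb' => ?_⟩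
    rw [inner_zero_left, real_inner_smul_right, real_inner_comm, hb', mul_zero, sub_zero, mul_zero]
end

section
/- Let n ≥ 1, let u ∈ ℝⁿ with ‖u‖ = 1, let n₀ > 0 be real, and let ν ∈ ℝⁿ. Write P v := v − ⟨u,v⟩ • u for the orthogonal projection onto u^⊥. On the subspace Ṽ = {(a,b) ∈ ℝⁿ × ℝⁿ : ⟨u,b⟩ + ⟨ν,a⟩ = 0} define the skew bilinear form σ̃((a,b),(a′,b′)) = n₀·(⟨P b, P a′⟩ − ⟨P b′, P a⟩) + ⟨P ν, P a⟩·⟨u,a′⟩ − ⟨P ν, P a′⟩·⟨u,a⟩. Then the kernel of σ̃ on Ṽ is the one-dimensional span of (a₀, b₀) with a₀ = u and b₀ = (1/n₀) • (ν − ⟨ν,u⟩ • u) − ⟨ν,u⟩ • u. -/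
open scoped RealInnerProductSpace

section UnitVectorProjection

variable {E : Type*} [NormedAddCommGroup E] [InnerProductSpace ℝ E] {u : E}

theorem inner_sub_inner_smul_self (hu : ‖u‖ = 1) (x : E) : ⟪u, x - ⟪u, x⟫ • u⟫ = 0 := by
  simp [inner_sub_right, inner_smul_right, hu]

/-- Only one argument of the inner product of two projections onto `u^⊥` needs projecting. -/
theorem inner_sub_inner_smul_sub_inner_smul (hu : ‖u‖ = 1) (x y : E) :
    ⟪x - ⟪u, x⟫ • u, y - ⟪u, y⟫ • u⟫ = ⟪x - ⟪u, x⟫ • u, y⟫ := by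
  rw [inner_sub_right, inner_smul_right, real_inner_comm, real_inner_comm u,
    inner_sub_inner_smul_self hu]
  ring

end UnitVectorProjection

/-- Pointwise content of the Fermat principle for conformally related Finsler
structures: with `P` the orthogonal projection onto `u^⊥`, on
`Ṽ = {(a,b) : ⟨u,b⟩ + ⟨ν,a⟩ = 0}` the kernel of
`σ̃((a,b),(a′,b′)) = n₀(⟨Pb,Pa′⟩ − ⟨Pb′,Pa⟩) + ⟨Pν,Pa⟩⟨u,a′⟩ − ⟨Pν,Pa′⟩⟨u,a⟩`
is the span of the conformal geodesic spray
`(a₀,b₀) = (u, (1/n₀)(ν − ⟨ν,u⟩u) − ⟨ν,u⟩u)`. -/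
theorem conformal_geodesic_spray_kernel
    (n : ℕ) (hn : 1 ≤ n)
    (u : EuclideanSpace ℝ (Fin n)) (hu : ‖u‖ = 1)
    (n₀ : ℝ) (hn₀ : 0 < n₀) (ν : EuclideanSpace ℝ (Fin n))
    (P : EuclideanSpace ℝ (Fin n) → EuclideanSpace ℝ (Fin n))
    (hP : ∀ v, P v = v - ⟪u, v⟫ • u)
    (a₀ b₀ : EuclideanSpace ℝ (Fin n)) (ha₀ : a₀ = u)
    (hb₀ : b₀ = (1 / n₀) • (ν - ⟪ν, u⟫ • u) - ⟪ν, u⟫ • u) :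
    {ab : EuclideanSpace ℝ (Fin n) × EuclideanSpace ℝ (Fin n) |
        ⟪u, ab.2⟫ + ⟪ν, ab.1⟫ = 0 ∧
        ∀ a' b' : EuclideanSpace ℝ (Fin n), ⟪u, b'⟫ + ⟪ν, a'⟫ = 0 →
          n₀ * (⟪P ab.2, P a'⟫ - ⟪P b', P ab.1⟫) +
              ⟪P ν, P ab.1⟫ * ⟪u, a'⟫ - ⟪P ν, P a'⟫ * ⟪u, ab.1⟫ = 0} =
      {ab : EuclideanSpace ℝ (Fin n) × EuclideanSpace ℝ (Fin n) |
        ∃ t : ℝ, ab = t • (a₀, b₀)} := by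
  subst ha₀ hb₀
  have hPu : ∀ x, ⟪a₀, P x⟫ = 0 := fun x => by rw [hP, inner_sub_inner_smul_self hu]
  have hPP : ∀ x y, ⟪P x, P y⟫ = ⟪P x, y⟫ := fun x y => by
    rw [hP, hP, inner_sub_inner_smul_sub_inner_smul hu]
  have huu : ⟪a₀, a₀⟫ = 1 := by simp [hu]
  have hPsmul : ∀ s : ℝ, P (s • a₀) = 0 := fun s => by
    simp [hP, inner_smul_right, hu]
  ext ⟨a, b⟩
  simp only [Set.mem_ofPred_eq, Prod.smul_mk, Prod.mk.injEq]
  constructor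
  · rintro ⟨hab, hker⟩
    have hPa : P a = 0 := by
      have h := hker 0 (P a) (by simp [hPu])
      have hP0 : P 0 = 0 := by simp [hP]
      rw [hP0, real_inner_comm (P a) (P (P a)), hPP a (P a)] at h
      simpa [hn₀.ne'] using h
    have ha : a = ⟪a₀, a⟫ • a₀ := sub_eq_zero.mp ((hP a).symm.trans hPa)
    have hPb : n₀ • P b = ⟪a₀, a⟫ • P ν := by
      set w := n₀ • P b - ⟪a₀, a⟫ • P ν with hw
      have h := hker w (-⟪ν, w⟫ • a₀) (by simp [inner_smul_right, hu])
      rw [hPsmul, hPa, hPP, hPP] at h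
      have hww : ⟪w, w⟫ = 0 := by
        nth_rewrite 1 [hw]
        rw [inner_sub_left, real_inner_smul_left, real_inner_smul_left]
        simp only [inner_zero_right] at h
        linarith
      exact sub_eq_zero.mp (inner_self_eq_zero.mp hww)
    refine ⟨⟪a₀, a⟫, ha, ?_⟩
    have hub : ⟪a₀, b⟫ = -(⟪a₀, a⟫ * ⟪ν, a₀⟫) := by
      rw [ha, inner_smul_right] at hab
      linarith
    have hb : b = P b + ⟪a₀, b⟫ • a₀ := by simp [hP]
    have hPb' : P b = (1 / n₀) • ⟪a₀, a⟫ • P ν := by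
      rw [← hPb, smul_smul, one_div_mul_cancel hn₀.ne', one_smul]
    rw [hb, hPb', hub, hP ν, real_inner_comm a₀ ν]
    module
  · rintro ⟨t, rfl, rfl⟩
    have hspray : P (t • ((1 / n₀) • (ν - ⟪ν, a₀⟫ • a₀) - ⟪ν, a₀⟫ • a₀)) = (t / n₀) • P ν := by
      simp only [hP, inner_smul_right, inner_sub_right, huu, real_inner_comm a₀ ν]
      module
    refine ⟨?_, fun a' b' _ => ?_⟩
    · simp only [inner_smul_right, inner_sub_right, huu, real_inner_comm a₀ ν]
      ring
    · rw [hspray, hPsmul, real_inner_smul_left, inner_smul_right, huu]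
      simp only [inner_zero_right]
      field_simp
      ring
end

section
/- Let p, s, r, q ∈ ℝ, let M be a real 2×2 matrix, and let ρ ∈ ℝ². Let J be the 2×2 matrix with rows (0, −1) and (1, 0), and write ε(a,a′) := ⟨J a, a′⟩ = a₀a′₁ − a₁a′₀. On W = ℝ² × ℝ × ℝ², with elements written X = (x, t, v), define the skew bilinear form σ(X, X′) = p(⟨v,x′⟩ − ⟨v′,x⟩) − (s − q/2)·ε(v,v′) + (r/2)·ε(x,x′) + (1/2)(⟨ρ,x⟩ t′ − ⟨ρ,x′⟩ t) + (1/2)(⟨x, M.mulVec v′⟩ − ⟨x′, M.mulVec v⟩). Set Δ := s − q/2 and Σ := Δ⁻¹ · det(p • 1 − (1/2) • M) + r/2, and assume Δ ≠ 0 and Σ ≠ 0. Then the kernel {X ∈ W : σ(X, Y) = 0 for all Y ∈ W} is the one-dimensional span of X₀ = (x₀, 1, v₀), where x₀ = −(1/(2Σ)) • J.mulVec ρ and v₀ = Δ⁻¹ • J.mulVec ((p • 1 − (1/2) • Mᵀ).mulVec x₀); in particular σ has rank 4. -/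
open Matrix

/-- The standard symplectic 2×2 matrix `J`, with rows `(0,−1)` and `(1,0)`. -/
def Jmat : Matrix (Fin 2) (Fin 2) ℝ := !![0, -1; 1, 0]

/-- The skew form `ε(a,a′) = ⟨J a, a′⟩ = a₀a′₁ − a₁a′₀` on `ℝ²`. -/
def eps (a a' : Fin 2 → ℝ) : ℝ := Jmat.mulVec a ⬝ᵥ a'

/-- Pointwise hv-frame content of the main theorem of Finslerian spinoptics:
on `W = ℝ² × ℝ × ℝ²`, the kernel of the skew bilinear form
`σ((x,t,v),(x′,t′,v′)) = p(⟨v,x′⟩ − ⟨v′,x⟩) − (s − q/2)ε(v,v′) + (r/2)ε(x,x′)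
+ ½(⟨ρ,x⟩t′ − ⟨ρ,x′⟩t) + ½(⟨x,Mv′⟩ − ⟨x′,Mv⟩)` is, when
`Δ = s − q/2 ≠ 0` and `Σ = Δ⁻¹ det(p·1 − ½M) + r/2 ≠ 0`, the one-dimensional
span of `X₀ = (x₀, 1, v₀)` with `x₀ = −(1/(2Σ)) J ρ` and
`v₀ = Δ⁻¹ J (p·1 − ½Mᵀ) x₀`; in particular `σ` has rank 4. -/
theorem finsler_spinoptics_characteristic_foliation
    (p s r q : ℝ) (M : Matrix (Fin 2) (Fin 2) ℝ) (ρ : Fin 2 → ℝ)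
    (Δ Sig : ℝ) (hΔdef : Δ = s - q / 2)
    (hSigdef : Sig = Δ⁻¹ * (p • (1 : Matrix (Fin 2) (Fin 2) ℝ) -
        (1 / 2 : ℝ) • M).det + r / 2)
    (hΔ : Δ ≠ 0) (hSig : Sig ≠ 0)
    (x₀ v₀ : Fin 2 → ℝ)
    (hx₀ : x₀ = -(1 / (2 * Sig)) • Jmat.mulVec ρ)
    (hv₀ : v₀ = Δ⁻¹ • Jmat.mulVec
        (((p • (1 : Matrix (Fin 2) (Fin 2) ℝ) - (1 / 2 : ℝ) • Mᵀ)).mulVec x₀)) :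
    {X : (Fin 2 → ℝ) × ℝ × (Fin 2 → ℝ) |
        ∀ Y : (Fin 2 → ℝ) × ℝ × (Fin 2 → ℝ),
          p * (X.2.2 ⬝ᵥ Y.1 - Y.2.2 ⬝ᵥ X.1) - (s - q / 2) * eps X.2.2 Y.2.2 +
              (r / 2) * eps X.1 Y.1 +
              (1 / 2) * ((ρ ⬝ᵥ X.1) * Y.2.1 - (ρ ⬝ᵥ Y.1) * X.2.1) +
              (1 / 2) * (X.1 ⬝ᵥ M.mulVec Y.2.2 - Y.1 ⬝ᵥ M.mulVec X.2.2) = 0} =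
      {X : (Fin 2 → ℝ) × ℝ × (Fin 2 → ℝ) |
        ∃ t : ℝ, X = t • (x₀, (1 : ℝ), v₀)} := by
  have hx0 : 2 * Sig * x₀ 0 = ρ 1 := by
    simp [hx₀, Jmat, dotProduct, Fin.sum_univ_two]
    field_simp
  have hx1 : 2 * Sig * x₀ 1 = -ρ 0 := by
    simp [hx₀, Jmat, dotProduct, Fin.sum_univ_two]
    field_simp
  have hv0 : Δ * v₀ 0 = -(-(1 / 2) * M 0 1 * x₀ 0 + (p - 1 / 2 * M 1 1) * x₀ 1) := by
    simp [hv₀, Jmat]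
    field_simp
  have hv1 : Δ * v₀ 1 = (p - 1 / 2 * M 0 0) * x₀ 0 - 1 / 2 * M 1 0 * x₀ 1 := by
    simp [hv₀, Jmat]
    field_simp
    ring
  have hS : Sig * Δ = (p - 1 / 2 * M 0 0) * (p - 1 / 2 * M 1 1) -
      1 / 4 * M 0 1 * M 1 0 + r / 2 * Δ := by
    rw [hSigdef, Matrix.det_fin_two]
    simp
    field_simp
    ring
  clear hx₀ hv₀ hSigdef
  rw [← hΔdef]
  ext ⟨x, t, v⟩
  simp only [Set.mem_ofPred_eq, Prod.forall, eps, Jmat, Matrix.mulVec, dotProduct,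
    Fin.sum_univ_two, Matrix.of_apply, Matrix.cons_val_zero, Matrix.cons_val_one,
    Prod.smul_mk, Prod.mk.injEq, smul_eq_mul, mul_one]
  constructor
  · intro h
    have a0 := h ![1, 0] 0 0
    have a1 := h ![0, 1] 0 0
    have b0 := h 0 0 ![1, 0]
    have b1 := h 0 0 ![0, 1]
    simp only [Matrix.cons_val_zero, Matrix.cons_val_one, Pi.zero_apply] at a0 a1 b0 b1
    have ex0 : x 0 = t * x₀ 0 := by
      apply mul_left_cancel₀ (mul_ne_zero hSig hΔ)
      linear_combination x 0 * hS - t * Δ / 2 * hx0 + Δ * a1 -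
        1 / 2 * M 1 0 * b1 - (p - 1 / 2 * M 1 1) * b0
    have ex1 : x 1 = t * x₀ 1 := by
      apply mul_left_cancel₀ (mul_ne_zero hSig hΔ)
      linear_combination x 1 * hS - t * Δ / 2 * hx1 - Δ * a0 -
        (p - 1 / 2 * M 0 0) * b1 - 1 / 2 * M 0 1 * b0
    have ev0 : v 0 = t * v₀ 0 := by
      apply mul_left_cancel₀ hΔ
      rw [ex0, ex1] at b1
      linear_combination -b1 - t * hv0
    have ev1 : v 1 = t * v₀ 1 := by
      apply mul_left_cancel₀ hΔ
      rw [ex0, ex1] at b0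
      linear_combination b0 - t * hv1
    refine ⟨t, ?_, rfl, ?_⟩ <;> ext i <;> fin_cases i <;> simpa
  · rintro ⟨t, rfl, rfl, rfl⟩ y u w
    have c : ρ 0 * x₀ 0 + ρ 1 * x₀ 1 = 0 := by
      linear_combination -x₀ 1 * hx0 + x₀ 0 * hx1
    have d0 : (p - 1 / 2 * M 0 0) * v₀ 0 - 1 / 2 * M 0 1 * v₀ 1 - r / 2 * x₀ 1 - ρ 0 / 2 = 0 := by
      apply mul_left_cancel₀ hΔ
      linear_combination (p - 1 / 2 * M 0 0) * hv0 - 1 / 2 * M 0 1 * hv1 +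
        x₀ 1 * hS - Δ / 2 * hx1
    have d1 : (p - 1 / 2 * M 1 1) * v₀ 1 - 1 / 2 * M 1 0 * v₀ 0 + r / 2 * x₀ 0 - ρ 1 / 2 = 0 := by
      apply mul_left_cancel₀ hΔ
      linear_combination (p - 1 / 2 * M 1 1) * hv1 - 1 / 2 * M 1 0 * hv0 -
        x₀ 0 * hS + Δ / 2 * hx0
    simp only [Pi.smul_apply, smul_eq_mul]
    linear_combination t * y 0 * d0 + t * y 1 * d1 + t * u / 2 * c +
      t * w 0 * hv1 - t * w 1 * hv0
end
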